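/- arXiv:math/0508027 — 6 statements merged into one kernel-verified Lean document; each statement's English description precedes it below -/
import Mathlib

section
/- Let p be a prime. There exists a sequence (f_k)_{k≥1} of locally constant, compactly supported functions ℚ_p → ℂ such that (i) for every x ∈ ℚ_p there exists N ∈ ℕ with f_k(x) = 0 for all k ≥ N, yet (ii) the sequence (f_k) is not negligible; more precisely, for the compact set K = ℤ_p and for every N ∈ ℕ there exist k ≥ N and x ∈ K with f_k(x) ≠ 0. Consequently, classical point values do not determine elements of the p-adic Colombeau–Egorov algebra 𝒢(ℚ_p) uniquely. -/
/-- The spheres of radius `‖p ^ k‖` around `0` in `ℚ_[p]` are open and closed. -/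
theorem Padic.isClopen_sphere_norm_pow (p : ℕ) [hp : Fact p.Prime] (k : ℕ) :
    IsClopen (Metric.sphere (0 : ℚ_[p]) ‖(p : ℚ_[p]) ^ k‖) :=
  IsUltrametricDist.isClopen_sphere 0
    (norm_ne_zero_iff.2 (pow_ne_zero k (Nat.cast_ne_zero.2 hp.out.ne_zero)))

/-- For a prime `p`, there is a sequence of locally constant, compactly supported
functions `ℚ_p → ℂ` all of whose standard point values vanish eventually, yet which
is not negligible (witnessed on the compact set `K = ℤ_p`). Hence classical point
values do not determine elements of `𝒢(ℚ_p)` uniquely. -/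
theorem stmt_4 (p : ℕ) [hp : Fact p.Prime] :
    ∃ f : ℕ → ℚ_[p] → ℂ,
      (∀ k, IsLocallyConstant (f k) ∧ HasCompactSupport (f k)) ∧
      (∀ x : ℚ_[p], ∃ N : ℕ, ∀ k ≥ N, f k x = 0) ∧
      (∀ N : ℕ, ∃ k ≥ N, ∃ x : ℚ_[p], ‖x‖ ≤ 1 ∧ f k x ≠ 0) := by
  refine ⟨fun k => LocallyConstant.charFn ℂ (Padic.isClopen_sphere_norm_pow p k),
    fun k => ⟨LocallyConstant.isLocallyConstant _, ?_⟩, fun x => ?_, fun N => ?_⟩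
  · refine HasCompactSupport.intro (isCompact_sphere (0 : ℚ_[p]) ‖(p : ℚ_[p]) ^ k‖) fun x hx => ?_
    simp only [LocallyConstant.coe_charFn]
    exact Set.indicator_of_notMem hx _
  · simp only [LocallyConstant.coe_charFn]
    have hlim : Filter.Tendsto (fun k : ℕ => ‖(p : ℚ_[p]) ^ k‖) Filter.atTop (nhds 0) := by
      simpa only [norm_pow] using
        tendsto_pow_atTop_nhds_zero_of_lt_one (norm_nonneg (p : ℚ_[p])) Padic.norm_p_lt_one
    rcases eq_or_ne x 0 with rfl | hx
    · refine ⟨0, fun k _ => Set.indicator_of_notMem ?_ _⟩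
      rw [mem_sphere_zero_iff_norm, norm_zero]
      exact (norm_pos_iff.2 (pow_ne_zero k (Nat.cast_ne_zero.2 hp.out.ne_zero))).ne
    · obtain ⟨N, hN⟩ := Filter.eventually_atTop.1 (hlim.eventually_lt_const (norm_pos_iff.2 hx))
      exact ⟨N, fun k hk => Set.indicator_of_notMem
        (fun h => (hN k hk).ne (mem_sphere_zero_iff_norm.1 h).symm) _⟩
  · refine ⟨N, le_rfl, (p : ℚ_[p]) ^ N, ?_, ?_⟩
    · rw [norm_pow]
      exact pow_le_one₀ (norm_nonneg _) Padic.norm_p_lt_one.le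
    · simp only [LocallyConstant.coe_charFn]
      rw [Set.indicator_of_mem (mem_sphere_zero_iff_norm.2 rfl)]
      exact one_ne_zero
end

section
/- Let (M,d) be a locally compact ultrametric space whose topology is not discrete, and let R be a nontrivial commutative ring. Then there exists a sequence (f_k)_{k≥1} of locally constant, compactly supported functions M → R such that (i) for every x ∈ M there exists N ∈ ℕ with f_k(x) = 0 for all k ≥ N, but (ii) (f_k) is not negligible, i.e., there exists a compact set K ⊆ M such that for every N ∈ ℕ there exist k ≥ N and x ∈ K with f_k(x) ≠ 0. Hence the ultrametric Egorov algebra 𝒢(M,R) does not admit a standard point value characterization. -/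
/-- If `(M,d)` is a locally compact, non-discrete ultrametric space and `R` a nontrivial
commutative ring, then there exists a sequence of locally constant, compactly supported
functions `M → R` whose value at each fixed point vanishes eventually but which is not
negligible. Hence `𝒢(M,R)` does not admit a standard point value characterization. -/
theorem stmt_7 {M : Type*} [MetricSpace M] [IsUltrametricDist M] [LocallyCompactSpace M]
    (hM : ¬ DiscreteTopology M)
    {R : Type*} [CommRing R] [Nontrivial R] :
    ∃ f : ℕ → M → R,
      (∀ k, IsLocallyConstant (f k) ∧ HasCompactSupport (f k)) ∧
      (∀ x : M, ∃ N : ℕ, ∀ k ≥ N, f k x = 0) ∧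
      (∃ K : Set M, IsCompact K ∧ ∀ N : ℕ, ∃ k ≥ N, ∃ x ∈ K, f k x ≠ 0) := by
  obtain ⟨p, hp⟩ : ∃ p : M, ¬ IsOpen ({p} : Set M) := by
    by_contra! h
    exact hM (discreteTopology_iff_isOpen_singleton.2 h)
  rw [Metric.isOpen_singleton_iff] at hp
  push Not at hp
  obtain ⟨K, hK, hKp⟩ := exists_compact_mem_nhds p
  obtain ⟨r, hr, hrK⟩ := Metric.mem_nhds_iff.1 hKp
  have hpos (k : ℕ) : 0 < min r (1 / ((k : ℝ) + 1)) := lt_min hr Nat.one_div_pos_of_nat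
  choose x hx hxp using fun k : ℕ => hp _ (hpos k)
  have hsub (k : ℕ) : Metric.sphere p (dist (x k) p) ⊆ K := fun y hy =>
    hrK (Metric.mem_ball.2 ((Metric.mem_sphere.1 hy).trans_lt ((hx k).trans_le (min_le_left _ _))))
  have hclopen (k : ℕ) : IsClopen (Metric.sphere p (dist (x k) p)) :=
    IsUltrametricDist.isClopen_sphere p (dist_ne_zero.2 (hxp k))
  refine ⟨fun k => (Metric.sphere p (dist (x k) p)).indicator fun _ => (1 : R), fun k => ⟨?_, ?_⟩,
    fun y => ?_, K, hK, fun N => ⟨N, le_rfl, x N, hsub N rfl, ?_⟩⟩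
  · exact ((LocallyConstant.const M (1 : R)).indicator (hclopen k)).isLocallyConstant
  · exact HasCompactSupport.intro hK fun y hy =>
      Set.indicator_of_notMem (fun h => hy (hsub k h)) _
  · obtain rfl | hy := eq_or_ne y p
    · refine ⟨0, fun k _ => Set.indicator_of_notMem (fun h => ?_) _⟩
      rw [Metric.mem_sphere, dist_self] at h
      exact hxp k (dist_eq_zero.1 h.symm)
    · obtain ⟨N, hN⟩ := exists_nat_one_div_lt (dist_pos.2 hy)
      refine ⟨N, fun k hk => Set.indicator_of_notMem (fun h => ?_) _⟩
      have hlt := ((hx k).trans_le (min_le_right _ _)).trans_le (Nat.one_div_le_one_div hk)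
      exact (hlt.trans hN).ne' h
  · simp
end

section
/- Let (M,d) be a locally compact ultrametric space and R a nontrivial commutative ring. Then the following are equivalent: (1) every sequence (f_k) of locally constant, compactly supported functions M → R such that for each x ∈ M one has f_k(x) = 0 for all sufficiently large k is negligible (i.e., 𝒢(M,R) admits a standard point value characterization); (2) the topology of (M,d) is discrete. -/
open scoped Topology


/-- For a locally compact ultrametric space `(M,d)` and a nontrivial commutative ring `R`,
the Egorov algebra `𝒢(M,R)` admits a standard point value characterization (every
sequence of locally constant, compactly supported functions whose value at each point
vanishes eventually is negligible) if and only if the topology of `M` is discrete. -/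
theorem stmt_9 {M : Type*} [MetricSpace M] [IsUltrametricDist M] [LocallyCompactSpace M]
    {R : Type*} [CommRing R] [Nontrivial R] :
    (∀ f : ℕ → M → R,
      (∀ k, IsLocallyConstant (f k) ∧ HasCompactSupport (f k)) →
      (∀ x : M, ∃ N : ℕ, ∀ k ≥ N, f k x = 0) →
      (∀ K : Set M, IsCompact K → ∃ N : ℕ, ∀ k ≥ N, ∀ x ∈ K, f k x = 0)) ↔
    DiscreteTopology M := by
  refine ⟨fun h => ?_, fun _ f _ hpt K hK => ?_⟩
  · rw [discreteTopology_iff_isOpen_singleton]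
    by_contra! hnot
    obtain ⟨p, hp⟩ := hnot
    have : (𝓝[≠] p).NeBot := by
      rw [Filter.neBot_iff, Ne, ← isOpen_singleton_iff_punctured_nhds]
      exact hp
    obtain ⟨K, hK, hKp⟩ := exists_compact_mem_nhds p
    obtain ⟨r, hr, hrK⟩ := Metric.mem_nhds_iff.mp hKp
    have hx : ∀ k : ℕ, ∃ x, x ≠ p ∧ dist x p < min r (1 / ((k : ℝ) + 1)) := fun k => by
      have hball : Metric.ball p (min r (1 / ((k : ℝ) + 1))) ∈ 𝓝[≠] p :=
        mem_nhdsWithin_of_mem_nhds (Metric.ball_mem_nhds p (lt_min hr (by positivity)))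
      obtain ⟨x, hxb, hxp⟩ :=
        Filter.nonempty_of_mem (Filter.inter_mem hball self_mem_nhdsWithin)
      exact ⟨x, hxp, hxb⟩
    choose x hxp hxd using hx
    have hsub : ∀ k, ∀ y ∈ Metric.ball (x k) (dist (x k) p), dist y p ≤ dist (x k) p :=
      fun k y hy => (dist_triangle_max y (x k) p).trans (max_le (Metric.mem_ball.mp hy).le le_rfl)
    obtain ⟨N, hN⟩ := h
      (fun k => (Metric.ball (x k) (dist (x k) p)).indicator (1 : M → R))
      (fun k => ⟨(LocallyConstant.charFn R
          (IsUltrametricDist.isClopen_ball (x k) (dist (x k) p))).isLocallyConstant,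
        HasCompactSupport.intro hK fun y hy => Set.indicator_of_notMem
          (fun hyb => hy (hrK ((hsub k y hyb).trans_lt
            ((hxd k).trans_le (min_le_left _ _))))) _⟩)
      (fun y => by
        rcases eq_or_ne y p with rfl | hy
        · exact ⟨0, fun k _ => Set.indicator_of_notMem (by simp [dist_comm]) _⟩
        · obtain ⟨N, hN⟩ := exists_nat_one_div_lt (dist_pos.mpr hy)
          refine ⟨N, fun k hk => Set.indicator_of_notMem (fun hyb => ?_) _⟩
          have hlt := (hxd k).trans_le (min_le_right _ _)
          have hle := Nat.one_div_le_one_div (α := ℝ) hk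
          linarith [hsub k y hyb])
      K hK
    have hzero := hN N le_rfl (x N) (hrK ((hxd N).trans_le (min_le_left _ _)))
    rw [Set.indicator_of_mem (Metric.mem_ball_self (dist_pos.mpr (hxp N)))] at hzero
    exact one_ne_zero hzero
  · choose N hN using hpt
    obtain ⟨B, hB⟩ := (hK.finite_of_discrete.image N).bddAbove
    exact ⟨B, fun k hk x hx => hN x k ((hB (Set.mem_image_of_mem N hx)).trans hk)⟩
end

section
/- Let (M,d) be a locally compact ultrametric space (non-discrete), R a nontrivial commutative ring, and (u_k)_{k≥1} a sequence of locally constant, compactly supported functions M → R. Then (u_k) is negligible if and only if for every compact set K ⊆ M and every sequence (x_k) of points of K there exists N ∈ ℕ such that u_k(x_k) = 0 for all k ≥ N. (Generalized point value characterization: an element of 𝒢(M,R) is zero iff it vanishes at every compactly supported generalized point.) -/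
/-- Generalized point value characterization: for a locally compact, non-discrete
ultrametric space `(M,d)`, a nontrivial commutative ring `R`, and a sequence `(u_k)` of
locally constant, compactly supported functions `M → R`, the sequence is negligible iff
for every compact `K ⊆ M` and every sequence of points of `K` the values `u_k (x_k)`
vanish eventually. -/
theorem stmt_10 {M : Type*} [MetricSpace M] [IsUltrametricDist M] [LocallyCompactSpace M]
    (hM : ¬ DiscreteTopology M)
    {R : Type*} [CommRing R] [Nontrivial R]
    (u : ℕ → M → R)
    (hu : ∀ k, IsLocallyConstant (u k) ∧ HasCompactSupport (u k)) :
    (∀ K : Set M, IsCompact K → ∃ N : ℕ, ∀ k ≥ N, ∀ x ∈ K, u k x = 0) ↔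
    (∀ K : Set M, IsCompact K → ∀ x : ℕ → M, (∀ k, x k ∈ K) →
      ∃ N : ℕ, ∀ k ≥ N, u k (x k) = 0) := by
  constructor
  · intro h K hK x hx
    obtain ⟨N, hN⟩ := h K hK
    exact ⟨N, fun k hk => hN k hk (x k) (hx k)⟩
  · intro h K hK
    rcases K.eq_empty_or_nonempty with rfl | ⟨p, hp⟩
    · exact ⟨0, fun k _ x hx => hx.elim⟩
    have witness : ∀ k, ∃ y ∈ K, u k y = 0 → ∀ x ∈ K, u k x = 0 := by
      intro k
      by_cases hk : ∃ y ∈ K, u k y ≠ 0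
      · obtain ⟨y, hy, hne⟩ := hk
        exact ⟨y, hy, fun h0 => absurd h0 hne⟩
      · push Not at hk
        exact ⟨p, hp, fun _ => hk⟩
    choose y hyK hy using witness
    obtain ⟨N, hN⟩ := h K hK y hyK
    exact ⟨N, fun k hk => hy k (hN k hk)⟩
end

section
/- Let p be a prime, let φ : ℕ → ℤ be a monotone function with φ(k) → ∞, and define f_k : ℚ_p → ℂ by f_k(x) = p^k if |x|_p ≤ p^{-φ(k)} and f_k(x) = 0 otherwise, and δ_k : ℚ_p → ℂ by δ_k(x) = p^k if |x|_p ≤ p^{-k} and δ_k(x) = 0 otherwise. Then for every x ∈ ℚ_p there exists N ∈ ℕ such that f_k(x) = δ_k(x) for all k ≥ N; i.e., the standard point values of [(f_k)_k] and of the imbedded δ-distribution ι(δ) coincide at every point of ℚ_p. -/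
open Filter in
/-- A nonzero `p`-adic number eventually leaves any sequence of balls around `0` whose radii
`p ^ (-ψ k)` shrink to `0`. -/
theorem Padic.eventually_zpow_neg_lt_norm {p : ℕ} [hp : Fact p.Prime] {ψ : ℕ → ℤ}
    (hψ : Tendsto ψ atTop atTop) {x : ℚ_[p]} (hx : x ≠ 0) :
    ∀ᶠ k in atTop, (p : ℝ) ^ (-ψ k) < ‖x‖ := by
  have hp1 : (1 : ℝ) < p := mod_cast hp.out.one_lt
  filter_upwards [hψ.eventually_gt_atTop x.valuation] with k hk
  rw [Padic.norm_eq_zpow_neg_valuation hx]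
  exact zpow_lt_zpow_right₀ hp1 (neg_lt_neg hk)

/-- For `φ : ℕ → ℤ` monotone with `φ(k) → ∞`, `f_k(x) = p^k` if `|x|_p ≤ p^{-φ(k)}` (else 0)
and `δ_k(x) = p^k` if `|x|_p ≤ p^{-k}` (else 0): at every point `x ∈ ℚ_p` the sequences
`(f_k(x))` and `(δ_k(x))` eventually coincide, i.e. the standard point values of `[(f_k)]`
and of `ι(δ)` coincide. -/
theorem stmt_12 (p : ℕ) [hp : Fact p.Prime]
    (φ : ℕ → ℤ) (hmono : Monotone φ) (htop : Filter.Tendsto φ Filter.atTop Filter.atTop)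
    (f δ : ℕ → ℚ_[p] → ℂ)
    (hf : ∀ k x, f k x = if ‖x‖ ≤ (p : ℝ) ^ (-(φ k)) then (p : ℂ) ^ k else 0)
    (hδ : ∀ k x, δ k x = if ‖x‖ ≤ (p : ℝ) ^ (-(k : ℤ)) then (p : ℂ) ^ k else 0) :
    ∀ x : ℚ_[p], ∃ N : ℕ, ∀ k ≥ N, f k x = δ k x := by
  intro x
  rcases eq_or_ne x 0 with rfl | hx
  · have h (n : ℤ) : (0 : ℝ) ≤ (p : ℝ) ^ n := by positivity
    exact ⟨0, fun k _ => by simp only [hf, hδ, norm_zero, h, if_true]⟩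
  · refine Filter.eventually_atTop.mp ?_
    filter_upwards [Padic.eventually_zpow_neg_lt_norm htop hx,
      Padic.eventually_zpow_neg_lt_norm tendsto_natCast_atTop_atTop hx] with k hφ hk
    rw [hf, hδ, if_neg hφ.not_ge, if_neg hk.not_ge]
end

section
/- Let p be a prime and δ_k(x) = p^k if |x|_p ≤ p^{-k}, 0 otherwise. There exists a sequence (f_k)_{k≥1} of locally constant, compactly supported functions ℚ_p → ℂ such that (i) for every x ∈ ℚ_p, f_k(x) = δ_k(x) for all sufficiently large k (so [(f_k)] and ι(δ) have identical standard point values), and (ii) the sequence (f_k − δ_k)_k is not negligible, i.e., [(f_k)] ≠ ι(δ) in 𝒢(ℚ_p). -/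
theorem IsClopen.isLocallyConstant_ite {X Y : Type*} [TopologicalSpace X] {s : Set X}
    [DecidablePred (· ∈ s)] (hs : IsClopen s) (a b : Y) :
    IsLocallyConstant fun x => if x ∈ s then a else b := by
  rw [IsLocallyConstant.iff_exists_open]
  intro x
  by_cases hx : x ∈ s
  · exact ⟨s, hs.isOpen, hx, fun y hy => by simp [hx, hy]⟩
  · exact ⟨sᶜ, hs.compl.isOpen, hx, fun y (hy : y ∉ s) => by simp [hx, hy]⟩

/-- For a prime `p` and `δ_k(x) = p^k` if `|x|_p ≤ p^{-k}` (else 0), there exists a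
sequence `(f_k)` of locally constant, compactly supported functions `ℚ_p → ℂ` such that
(i) at every point `x ∈ ℚ_p`, `f_k(x) = δ_k(x)` for all sufficiently large `k` (identical
standard point values), yet (ii) `(f_k - δ_k)` is not negligible, i.e. `[(f_k)] ≠ ι(δ)`
in `𝒢(ℚ_p)`. -/
theorem stmt_15 (p : ℕ) [hp : Fact p.Prime]
    (δ : ℕ → ℚ_[p] → ℂ)
    (hδ : ∀ k x, δ k x = if ‖x‖ ≤ (p : ℝ) ^ (-(k : ℤ)) then (p : ℂ) ^ k else 0) :
    ∃ f : ℕ → ℚ_[p] → ℂ,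
      (∀ k, IsLocallyConstant (f k) ∧ HasCompactSupport (f k)) ∧
      (∀ x : ℚ_[p], ∃ N : ℕ, ∀ k ≥ N, f k x = δ k x) ∧
      (¬ ∀ K : Set ℚ_[p], IsCompact K → ∃ N : ℕ, ∀ k ≥ N, ∀ x ∈ K, f k x - δ k x = 0) := by
  classical
  have hp0 : (0 : ℝ) < p := by exact_mod_cast hp.out.pos
  have hp1 : (1 : ℝ) < p := by exact_mod_cast hp.out.one_lt
  have hpos (k : ℕ) : 0 < (p : ℝ) ^ (-(k : ℤ)) := zpow_pos hp0 _
  refine ⟨fun k x => δ k x + if ‖x‖ = (p : ℝ) ^ (-(k : ℤ)) then 1 else 0,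
    fun k => ⟨?_, ?_⟩, fun x => ?_, fun h => ?_⟩
  · have h1 := (IsUltrametricDist.isClopen_closedBall (0 : ℚ_[p])
      (hpos k).ne').isLocallyConstant_ite ((p : ℂ) ^ k) 0
    have h2 := (IsUltrametricDist.isClopen_sphere (0 : ℚ_[p])
      (hpos k).ne').isLocallyConstant_ite (1 : ℂ) 0
    convert h1.add h2 using 1
    ext x
    simp [hδ]
  · refine HasCompactSupport.intro
      (isCompact_closedBall (0 : ℚ_[p]) ((p : ℝ) ^ (-(k : ℤ)))) fun x hx => ?_
    rw [mem_closedBall_zero_iff] at hx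
    have hne : ‖x‖ ≠ (p : ℝ) ^ (-(k : ℤ)) := fun h => hx h.le
    simp only [hδ, if_neg hx, if_neg hne, add_zero]
  · rcases eq_or_ne x 0 with rfl | hx
    · refine ⟨0, fun k _ => ?_⟩
      simp only [norm_zero, if_neg (hpos k).ne, add_zero]
    · refine ⟨x.valuation.toNat + 1, fun k hk => ?_⟩
      have hne : ‖x‖ ≠ (p : ℝ) ^ (-(k : ℤ)) := by
        rw [Padic.norm_eq_zpow_neg_valuation hx]
        intro h
        have := zpow_right_injective₀ hp0 hp1.ne' h
        omega
      simp only [if_neg hne, add_zero]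
  · obtain ⟨N, hN⟩ := h (Metric.closedBall 0 1) (isCompact_closedBall _ _)
    have hnorm : ‖(p : ℚ_[p]) ^ N‖ = (p : ℝ) ^ (-(N : ℤ)) := Padic.norm_p_pow N
    have := hN N le_rfl ((p : ℚ_[p]) ^ N) (by
      rw [mem_closedBall_zero_iff, hnorm]
      exact zpow_le_one_of_nonpos₀ hp1.le (by simp))
    simp only [if_pos hnorm, add_sub_cancel_left, one_ne_zero] at this
end
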